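/- Let π : ℝ^d → ℝ be an everywhere strictly positive probability density with respect to Lebesgue measure whose second-order partial derivatives exist everywhere, let μ be the probability measure with density π, and let γ^d denote the standard Gaussian measure on ℝ^d. Let S : ℝ^d → ℝ^d be a twice continuously differentiable lower triangular monotone map that transports μ to γ^d. Then the following are equivalent: (a) there exist strictly increasing continuous bijections h_1,…,h_d : ℝ → ℝ and continuous functions g_1,…,g_d : ℝ^d → ℝ, with g_k depending only on the coordinates x_1,…,x_{k-1}, such that under μ the random variables U_k(x) := h_k^{-1}(x_k) − g_k(x), k = 1,…,d, are mutually independent and each U_k has a positive continuous density (i.e., μ is induced by a post-nonlinear model compatible with the identity ordering); (b) for each k ∈ {1,…,d} there exists a strictly increasing twice differentiable map B_k : ℝ → ℝ such that for every ℓ ≠ k, ∂²/∂x_ℓ ∂x_k [B_k(S_k(x))] = 0 for all x ∈ ℝ^d. -/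

import Mathlib

open MeasureTheory ProbabilityTheory

/-- A map `S : ℝ^d → ℝ^d` is lower triangular if each component `S_k` depends only on the
coordinates `x_1, …, x_k`. -/
def LowerTriangular (d : ℕ) (S : (Fin d → ℝ) → Fin d → ℝ) : Prop :=
  ∀ k : Fin d, ∀ x y : Fin d → ℝ, (∀ i ≤ k, x i = y i) → S x k = S y k

/-- A map `S : ℝ^d → ℝ^d` is monotone (in the triangular sense) if for each `k` and each fixed
`x_1, …, x_{k-1}`, the map `t ↦ S_k(x_1,…,x_{k-1},t)` is strictly increasing. -/
def MonotoneLast (d : ℕ) (S : (Fin d → ℝ) → Fin d → ℝ) : Prop :=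
  ∀ (k : Fin d) (x : Fin d → ℝ), StrictMono fun t => S (Function.update x k t) k


/-! ### Topological preliminaries -/

/-- local control of the first coordinates by the first components of a triangular map -/
lemma tri_control {d : ℕ} {S : (Fin d → ℝ) → Fin d → ℝ} (hc : Continuous S)
    (htri : LowerTriangular d S) (hmon : MonotoneLast d S) (x0 : Fin d → ℝ) :
    ∀ n : ℕ, ∀ ε > 0, ∃ δ > 0, ∀ x : Fin d → ℝ,
      (∀ i : Fin d, i.val < n → |S x i - S x0 i| < δ) →
      ∀ i : Fin d, i.val < n → |x i - x0 i| < ε := by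
  intro n
  induction n with
  | zero => intro ε hε; exact ⟨1, one_pos, fun x _ i hi => absurd hi (Nat.not_lt_zero _)⟩
  | succ n ih =>
    intro ε hε
    by_cases hn : n < d
    · set k : Fin d := ⟨n, hn⟩ with hk
      set xp := Function.update x0 k (x0 k + ε) with hxp
      set xm := Function.update x0 k (x0 k - ε) with hxm
      have h1 : S x0 k < S xp k := by
        have := hmon k x0 (show x0 k < x0 k + ε by linarith)
        simpa using this
      have h2 : S xm k < S x0 k := by
        have := hmon k x0 (show x0 k - ε < x0 k by linarith)
        simpa using this
      set η := min (S xp k - S x0 k) (S x0 k - S xm k) / 2 with hη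
      have hηpos : 0 < η := by
        have : 0 < min (S xp k - S x0 k) (S x0 k - S xm k) := lt_min (by linarith) (by linarith)
        positivity
      have hη1 : 2 * η ≤ S xp k - S x0 k := by
        rw [hη]; linarith [min_le_left (S xp k - S x0 k) (S x0 k - S xm k)]
      have hη2 : 2 * η ≤ S x0 k - S xm k := by
        rw [hη]; linarith [min_le_right (S xp k - S x0 k) (S x0 k - S xm k)]
      have hck : Continuous fun x => S x k := (continuous_apply k).comp hc
      obtain ⟨r1, hr1, hb1⟩ := Metric.continuous_iff.1 hck xp η hηpos
      obtain ⟨r2, hr2, hb2⟩ := Metric.continuous_iff.1 hck xm η hηpos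
      obtain ⟨δ, hδ, hD⟩ := ih (min ε (min r1 r2)) (by positivity)
      refine ⟨min δ η, by positivity, fun x hx => ?_⟩
      have hlow := hD x (fun i hi => lt_of_lt_of_le (hx i (by omega)) (min_le_left _ _))
      intro i hi
      by_cases hin : i.val < n
      · exact lt_of_lt_of_le (hlow i hin) (min_le_left _ _)
      · have hik : i = k := by ext; simp [hk]; omega
        rw [hik] at hi ⊢
        have hSk := lt_of_lt_of_le (hx k hi) (min_le_right _ _)
        rw [abs_lt] at hSk ⊢
        have key : ∀ (t r : ℝ), 0 < r → min ε (min r1 r2) ≤ r →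
            dist (fun j => if j < k then x j else Function.update x0 k t j)
              (Function.update x0 k t) < r := by
          intro t r hr hrr
          rw [dist_pi_lt_iff hr]
          intro j
          by_cases hj : j < k
          · have hj' : j.val < n := hj
            simp only [hj, if_true, Function.update_of_ne hj.ne]
            rw [Real.dist_eq]
            exact lt_of_lt_of_le (hlow j hj') hrr
          · simp [hj, hr]
        have key2 : ∀ t : ℝ, S (fun j => if j < k then x j else Function.update x0 k t j) k
            = S (Function.update x k t) k := by
          intro t
          apply htri
          intro j hj
          rcases lt_or_eq_of_le hj with h | h
          · simp [h, Function.update_of_ne h.ne]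
          · subst h; simp
        have e1 := hb1 _ (key (x0 k + ε) r1 hr1
          ((min_le_right _ _).trans (min_le_left _ _)))
        have e2 := hb2 _ (key (x0 k - ε) r2 hr2
          ((min_le_right _ _).trans (min_le_right _ _)))
        rw [key2, Real.dist_eq, abs_lt] at e1 e2
        have m := (hmon k x)
        have hxx : S x k = S (Function.update x k (x k)) k := by simp
        constructor
        · by_contra hcon
          have := m.monotone (show x k ≤ x0 k - ε by linarith)
          rw [← hxx] at this
          linarith [e2.2, hSk.1]
        · by_contra hcon
          have := m.monotone (show x0 k + ε ≤ x k by linarith)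
          rw [← hxx] at this
          linarith [e1.1, hSk.2]
    · obtain ⟨δ, hδ, hD⟩ := ih ε hε
      exact ⟨δ, hδ, fun x hx i hi => hD x (fun j hj => hx j (by omega)) i (by omega)⟩

/-- the same in terms of continuous functions of the first coordinates -/
lemma tri_control_fun {d : ℕ} {S : (Fin d → ℝ) → Fin d → ℝ} (hc : Continuous S)
    (htri : LowerTriangular d S) (hmon : MonotoneLast d S) (x0 : Fin d → ℝ) (k : Fin d)
    (N : Set (Fin d → ℝ)) (hN : N ∈ nhds x0) :
    ∃ δ > 0, ∀ x : Fin d → ℝ, (∀ i < k, |S x i - S x0 i| < δ) →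
      (fun j => if j < k then x j else x0 j) ∈ N := by
  obtain ⟨ε, hε, hb⟩ := Metric.mem_nhds_iff.1 hN
  obtain ⟨δ, hδ, hD⟩ := tri_control hc htri hmon x0 k.val ε hε
  refine ⟨δ, hδ, fun x hx => hb ?_⟩
  rw [Metric.mem_ball, dist_pi_lt_iff hε]
  intro j
  by_cases hj : j < k
  · simp only [hj, if_true, Real.dist_eq]
    exact hD x (fun i hi => hx i hi) j hj
  · simp [hj, hε]

/-! ### Measure preliminaries -/

lemma gauss_isOpenPos (d : ℕ) :
    (Measure.pi fun _ : Fin d => gaussianReal 0 1).IsOpenPosMeasure := by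
  have : (gaussianReal 0 1).IsOpenPosMeasure :=
    (gaussianReal_absolutelyContinuous' 0 one_ne_zero).isOpenPosMeasure
  infer_instance

lemma mu_isOpenPos {d : ℕ} {π : (Fin d → ℝ) → ℝ} (hpos : ∀ x, 0 < π x) (hc : Continuous π) :
    (volume.withDensity fun x => ENNReal.ofReal (π x)).IsOpenPosMeasure := by
  apply Measure.AbsolutelyContinuous.isOpenPosMeasure (μ := volume)
  apply withDensity_absolutelyContinuous'
  · exact hc.measurable.ennreal_ofReal.aemeasurable
  · exact Filter.Eventually.of_forall fun x => by simp [hpos x]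

/-- values of a transport map are dense -/
lemma exists_mem_open {d : ℕ} {μ : Measure (Fin d → ℝ)} {S : (Fin d → ℝ) → Fin d → ℝ}
    (hc : Continuous S)
    (hpush : μ.map S = Measure.pi fun _ : Fin d => gaussianReal 0 1)
    (O : Set (Fin d → ℝ)) (hO : IsOpen O) (hne : O.Nonempty) : ∃ x, S x ∈ O := by
  have := gauss_isOpenPos d
  have h := hO.measure_pos (Measure.pi fun _ : Fin d => gaussianReal 0 1) hne
  rw [← hpush, Measure.map_apply hc.measurable hO.measurableSet] at h
  obtain ⟨x, hx⟩ := nonempty_of_measure_ne_zero h.ne'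
  exact ⟨x, hx⟩

/-- boxes in the first coordinates are open -/
lemma isOpen_box {d : ℕ} (k : Fin d) (a : Fin d → ℝ) (δ : ℝ) :
    IsOpen {z : Fin d → ℝ | ∀ i : Fin d, i < k → |z i - a i| < δ} := by
  simp only [Set.ofPred_forall]
  apply isOpen_iInter_of_finite
  intro i
  apply isOpen_iInter_of_finite
  intro hi
  exact isOpen_lt (by fun_prop) continuous_const

/-- Lemma P -/
lemma exists_near {d : ℕ} {μ : Measure (Fin d → ℝ)} {S : (Fin d → ℝ) → Fin d → ℝ}
    (hc : Continuous S) (htri : LowerTriangular d S) (hmon : MonotoneLast d S)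
    (hpush : μ.map S = Measure.pi fun _ : Fin d => gaussianReal 0 1)
    (k : Fin d) (g : (Fin d → ℝ) → ℝ) (hg : Continuous g)
    (hgt : ∀ x y : Fin d → ℝ, (∀ i < k, x i = y i) → g x = g y)
    (x0 : Fin d → ℝ) (ε : ℝ) (hε : 0 < ε) (V : Set ℝ) (hV : IsOpen V) (hVn : V.Nonempty) :
    ∃ x, |g x - g x0| < ε ∧ S x k ∈ V := by
  have hN : {x | |g x - g x0| < ε} ∈ nhds x0 := by
    apply IsOpen.mem_nhds
    · exact isOpen_lt (by fun_prop) continuous_const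
    · simp [hε]
  obtain ⟨δ, hδ, hD⟩ := tri_control_fun hc htri hmon x0 k _ hN
  obtain ⟨v, hv⟩ := hVn
  set O : Set (Fin d → ℝ) := {z | (∀ i : Fin d, i < k → |z i - S x0 i| < δ) ∧ z k ∈ V}
  have hO : IsOpen O := by
    exact (isOpen_box k (S x0) δ).inter (hV.preimage (continuous_apply k))
  obtain ⟨x, hx⟩ := exists_mem_open hc hpush O hO
    ⟨Function.update (S x0) k v, fun i hi => by simp [Function.update_of_ne hi.ne, hδ], by simpa⟩
  refine ⟨x, ?_, hx.2⟩
  have := hD x hx.1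
  simp only [Set.mem_ofPred_eq] at this
  rwa [hgt _ x (fun i hi => by simp [hi])] at this

/-- one half of the uniqueness of the Knothe-Rosenblatt map -/
lemma kr_le {d : ℕ} {μ : Measure (Fin d → ℝ)} [IsProbabilityMeasure μ] [μ.IsOpenPosMeasure]
    {S T : (Fin d → ℝ) → Fin d → ℝ}
    (hS : Continuous S) (hStri : LowerTriangular d S) (hSmon : MonotoneLast d S)
    (hT : Continuous T) (hTtri : LowerTriangular d T) (hTmon : MonotoneLast d T)
    (hpush : μ.map S = μ.map T) (k : Fin d) (hlt : ∀ i < k, ∀ x, S x i = T x i)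
    (x0 : Fin d → ℝ) : T x0 k ≤ S x0 k := by
  by_contra hcon
  push Not at hcon
  obtain ⟨c, hc1, hc2⟩ := exists_between hcon
  have hSk : Continuous fun x => S x k := (continuous_apply k).comp hS
  have hTk : Continuous fun x => T x k := (continuous_apply k).comp hT
  have hNo : IsOpen {x | S x k < c ∧ c < T x k} :=
    (isOpen_lt hSk continuous_const).inter (isOpen_lt continuous_const hTk)
  obtain ⟨δ, hδ, hD⟩ := tri_control_fun hS hStri hSmon x0 k _ (hNo.mem_nhds ⟨hc1, hc2⟩)
  set Q : Set (Fin d → ℝ) := {z | ∀ i : Fin d, i < k → |z i - S x0 i| < δ} with hQ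
  have hQo : IsOpen Q := isOpen_box k (S x0) δ
  have hAm : MeasurableSet (Q ∩ {z | z k ≤ c}) :=
    hQo.measurableSet.inter (measurableSet_le (by fun_prop) measurable_const)
  have hQST : ∀ x, S x ∈ Q ↔ T x ∈ Q := by
    intro x
    simp only [hQ, Set.mem_ofPred_eq]
    refine forall_congr' fun i => ⟨fun h hi => ?_, fun h hi => ?_⟩
    · rw [← hlt i hi]; exact h hi
    · rw [hlt i hi]; exact h hi
  have hsub : T ⁻¹' (Q ∩ {z | z k ≤ c}) ⊆ S ⁻¹' (Q ∩ {z | z k ≤ c}) := by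
    rintro x ⟨hxQ, hxc⟩
    have hxQ' : S x ∈ Q := (hQST x).2 hxQ
    refine ⟨hxQ', ?_⟩
    have hm := hD x hxQ'
    simp only [Set.mem_ofPred_eq] at hm hxc ⊢
    rw [hStri k _ (Function.update x k (x0 k)) (fun j hj => by
        rcases lt_or_eq_of_le hj with h | h
        · simp [h, Function.update_of_ne h.ne]
        · subst h; simp),
      hTtri k _ (Function.update x k (x0 k)) (fun j hj => by
        rcases lt_or_eq_of_le hj with h | h
        · simp [h, Function.update_of_ne h.ne]
        · subst h; simp)] at hm
    have hlt' : x k < x0 k := by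
      apply (hTmon k x).lt_iff_lt.1
      simp only [Function.update_eq_self]
      linarith [hm.2]
    have := hSmon k x hlt'
    simp only [Function.update_eq_self] at this
    linarith [hm.1]
  have hmeas : μ (S ⁻¹' (Q ∩ {z | z k ≤ c})) = μ (T ⁻¹' (Q ∩ {z | z k ≤ c})) := by
    rw [← Measure.map_apply hS.measurable hAm, ← Measure.map_apply hT.measurable hAm, hpush]
  have hdiff : μ (S ⁻¹' (Q ∩ {z | z k ≤ c}) \ T ⁻¹' (Q ∩ {z | z k ≤ c})) = 0 := by
    rw [measure_sdiff hsub (hT.measurable hAm).nullMeasurableSet (measure_ne_top _ _), hmeas,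
      tsub_self]
  have hopen : IsOpen (S ⁻¹' Q ∩ {x | S x k < c ∧ c < T x k}) := (hQo.preimage hS).inter hNo
  have hp := hopen.measure_pos μ ⟨x0, by simp [hQ, hδ], hc1, hc2⟩
  apply hp.ne'
  refine measure_mono_null ?_ hdiff
  rintro x ⟨hx, hx1, hx2⟩
  refine ⟨⟨hx, hx1.le⟩, fun h => ?_⟩
  have : T x k ≤ c := h.2
  linarith

lemma kr_unique {d : ℕ} {μ : Measure (Fin d → ℝ)} [IsProbabilityMeasure μ] [μ.IsOpenPosMeasure]
    {S T : (Fin d → ℝ) → Fin d → ℝ}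
    (hS : Continuous S) (hStri : LowerTriangular d S) (hSmon : MonotoneLast d S)
    (hT : Continuous T) (hTtri : LowerTriangular d T) (hTmon : MonotoneLast d T)
    (hpush : μ.map S = μ.map T) : ∀ (n : ℕ) (k : Fin d), k.val < n → ∀ x, S x k = T x k := by
  intro n
  induction n with
  | zero => intro k hk; exact absurd hk (Nat.not_lt_zero _)
  | succ n ih =>
    intro k hk x
    have h : ∀ i < k, ∀ x, S x i = T x i := fun i hi => ih i (by
      have : i.val < k.val := hi
      omega)
    exact le_antisymm (kr_le hT hTtri hTmon hS hStri hSmon hpush.symm k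
      (fun i hi x => (h i hi x).symm) x) (kr_le hS hStri hSmon hT hTtri hTmon hpush k h x)

/-! ### Positivity of the diagonal derivatives -/

lemma gauss_le_volume : gaussianReal 0 1 ≤ (volume : Measure ℝ) := by
  rw [gaussianReal_of_var_ne_zero 0 one_ne_zero]
  conv_rhs => rw [← withDensity_one (μ := (volume : Measure ℝ))]
  apply withDensity_mono
  refine Filter.Eventually.of_forall fun x => ?_
  simp only [gaussianPDF, Pi.one_apply, ENNReal.ofReal_le_one, gaussianPDFReal]
  apply mul_le_one₀
  · apply inv_le_one_of_one_le₀
    rw [Real.one_le_sqrt]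
    have := Real.pi_gt_three
    simp; linarith
  · positivity
  · rw [Real.exp_le_one_iff]
    have : 0 ≤ (x - 0)^2 / (2 * ((1 : NNReal) : ℝ)) := by positivity
    rw [neg_div]; linarith

lemma pi_gauss_le (d : ℕ) :
    (Measure.pi fun _ : Fin d => gaussianReal 0 1) ≤ (volume : Measure (Fin d → ℝ)) := by
  have h : (Measure.pi fun _ : Fin d => gaussianReal 0 1).toOuterMeasure ≤
      OuterMeasure.pi fun _ : Fin d => (volume : Measure ℝ).toOuterMeasure := by
    rw [OuterMeasure.le_pi]
    intro s _
    change (Measure.pi fun _ : Fin d => gaussianReal 0 1) _ ≤ _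
    rw [Measure.pi_pi]
    exact Finset.prod_le_prod' fun i _ => gauss_le_volume _
  rw [Measure.le_iff]
  intro s hs
  refine (h s).trans ?_
  rw [volume_pi, Measure.pi, toMeasure_apply _ _ hs]

lemma tri_injective {d : ℕ} {S : (Fin d → ℝ) → Fin d → ℝ}
    (htri : LowerTriangular d S) (hmon : MonotoneLast d S) : Function.Injective S := by
  intro x y hxy
  have : ∀ (n : ℕ) (k : Fin d), k.val < n → x k = y k := by
    intro n
    induction n with
    | zero => intro k hk; exact absurd hk (Nat.not_lt_zero _)
    | succ n ih =>
      intro k hk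
      apply (hmon k x).injective
      simp only [Function.update_eq_self]
      rw [congrFun hxy k]
      apply htri
      intro j hj
      rcases lt_or_eq_of_le hj with h | h
      · rw [Function.update_of_ne h.ne]
        exact (ih j (by have : j.val < k.val := h; omega)).symm
      · subst h; simp
  funext k
  exact this _ k (Nat.lt_succ_self _)

lemma det_ge {d : ℕ} {π : (Fin d → ℝ) → ℝ} (hpos : ∀ x, 0 < π x) (hπ : Continuous π)
    {μ : Measure (Fin d → ℝ)}
    (hμ : μ = volume.withDensity fun x => ENNReal.ofReal (π x))
    {S : (Fin d → ℝ) → Fin d → ℝ}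
    (hSreg : ContDiff ℝ 2 S)
    (htri : LowerTriangular d S) (hmon : MonotoneLast d S)
    (hpush : μ.map S = Measure.pi fun _ : Fin d => gaussianReal 0 1) (x : Fin d → ℝ) :
    (fderiv ℝ S x).det ≠ 0 := by
  intro h0
  have hinj := tri_injective htri hmon
  have hcd : Continuous fun y => (fderiv ℝ S y).det :=
    ContinuousLinearMap.continuous_det.comp (hSreg.continuous_fderiv (by norm_num))
  have hA : IsOpen {y | |(fderiv ℝ S y).det| < π y} := isOpen_lt hcd.abs hπ
  set A := {y | |(fderiv ℝ S y).det| < π y} with hAdef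
  have hxA : x ∈ A := by simp [hAdef, h0, hpos x]
  obtain ⟨K, hKc, hxK, hKA⟩ := exists_compact_subset hA hxA
  set V := interior K
  have hVA : V ⊆ A := interior_subset.trans hKA
  have hVo : IsOpen V := isOpen_interior
  have hvol : volume V ≠ ⊤ := ((measure_mono interior_subset).trans_lt hKc.measure_lt_top).ne
  have hme : MeasurableSet (S '' V) :=
    (hSreg.continuous.measurableEmbedding hinj).measurableSet_image' hVo.measurableSet
  have e1 : μ V ≤ ∫⁻ y in V, ENNReal.ofReal |(fderiv ℝ S y).det| := by
    rw [lintegral_abs_det_fderiv_eq_addHaar_image volume hVo.measurableSet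
      (fun y _ => (hSreg.differentiable (by norm_num) y).hasFDerivAt.hasFDerivWithinAt)
      hinj.injOn]
    refine le_trans ?_ (pi_gauss_le d _)
    rw [← hpush, Measure.map_apply hSreg.continuous.measurable hme, Set.preimage_image_eq _ hinj]
  have e2 : ∫⁻ y in V, ENNReal.ofReal |(fderiv ℝ S y).det| < μ V := by
    rw [hμ, withDensity_apply _ hVo.measurableSet]
    have hV0 : volume V ≠ 0 := (hVo.measure_pos volume ⟨x, hxK⟩).ne'
    apply lintegral_strict_mono
    · simpa using hV0
    · exact hπ.measurable.ennreal_ofReal.aemeasurable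
    · have hb : BddAbove ((fun y => |(fderiv ℝ S y).det|) '' K) :=
        (hKc.image hcd.abs).bddAbove
      obtain ⟨M, hM⟩ := hb
      refine (lt_of_le_of_lt (setLIntegral_mono (g := fun _ => ENNReal.ofReal M)
        measurable_const fun y hy => ENNReal.ofReal_le_ofReal
          (hM ⟨y, interior_subset hy, rfl⟩)) ?_).ne
      rw [setLIntegral_const]
      exact ENNReal.mul_lt_top ENNReal.ofReal_lt_top hvol.lt_top
    · rw [ae_restrict_iff' hVo.measurableSet]
      refine Filter.Eventually.of_forall fun y hy => ?_
      exact (ENNReal.ofReal_lt_ofReal_iff (hpos y)).2 (hVA hy)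
  exact absurd e1 (not_le.2 e2)

lemma diag_ne_zero {d : ℕ} {π : (Fin d → ℝ) → ℝ} (hpos : ∀ x, 0 < π x) (hπ : Continuous π)
    {μ : Measure (Fin d → ℝ)}
    (hμ : μ = volume.withDensity fun x => ENNReal.ofReal (π x))
    {S : (Fin d → ℝ) → Fin d → ℝ}
    (hSreg : ContDiff ℝ 2 S)
    (htri : LowerTriangular d S) (hmon : MonotoneLast d S)
    (hpush : μ.map S = Measure.pi fun _ : Fin d => gaussianReal 0 1) (x : Fin d → ℝ)
    (k : Fin d) : fderiv ℝ (fun z => S z k) x (Pi.single k 1) ≠ 0 := by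
  have hdet := det_ge hpos hπ hμ hSreg htri hmon hpush x
  have hdiff : DifferentiableAt ℝ S x := hSreg.differentiable (by norm_num) x
  have hcomp : ∀ (k : Fin d) v, fderiv ℝ (fun z => S z k) x v = fderiv ℝ S x v k := by
    intro k v
    have := (hasFDerivAt_pi'.1 hdiff.hasFDerivAt k).fderiv
    rw [this]; rfl
  have hM : (fderiv ℝ S x).det =
      (LinearMap.toMatrix' (fderiv ℝ S x : (Fin d → ℝ) →ₗ[ℝ] (Fin d → ℝ))).det := by
    rw [LinearMap.det_toMatrix']
  rw [hM, Matrix.det_of_isLowerTriangular] at hdet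
  · rw [Finset.prod_ne_zero_iff] at hdet
    have := hdet k (Finset.mem_univ k)
    rw [LinearMap.toMatrix'_apply] at this
    rw [hcomp]
    simpa [Pi.single_apply, ← Pi.single_apply] using this
  · intro i j hij
    have hij' : i < j := hij
    rw [LinearMap.toMatrix'_apply]
    have h1 : fderiv ℝ S x (Pi.single j 1) i = 0 := by
      rw [← hcomp]
      have hd : DifferentiableAt ℝ (fun z => S z i) x := by fun_prop
      rw [← hd.lineDeriv_eq_fderiv]
      have : (fun t : ℝ => S (x + t • Pi.single j 1) i) = fun t => S x i := by
        funext t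
        apply htri
        intro l hl
        have : l ≠ j := (lt_of_le_of_lt hl hij').ne
        simp [this]
      rw [lineDeriv, this]; simp
    simpa [Pi.single_apply, ← Pi.single_apply] using h1

/-! ### One-dimensional transport -/

lemma cdf_hasDerivAt (p : ℝ → ℝ) (hp : Continuous p) (hpos : ∀ t, 0 < p t) (ν : Measure ℝ)
    [IsProbabilityMeasure ν] (hν : ν = volume.withDensity fun t => ENNReal.ofReal (p t)) (t : ℝ) :
    HasDerivAt (cdf ν) (p t) t := by
  have hintg : Integrable p := by
    refine ⟨hp.aestronglyMeasurable, ?_⟩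
    rw [hasFiniteIntegral_iff_ofReal (Filter.Eventually.of_forall fun x => (hpos x).le)]
    have : ν Set.univ = 1 := measure_univ
    rw [hν, withDensity_apply _ MeasurableSet.univ, Measure.restrict_univ] at this
    rw [this]; exact ENNReal.one_lt_top
  have hF : ∀ s, cdf ν s = ∫ x in Set.Iic s, p x := by
    intro s
    rw [cdf_eq_real, measureReal_def, hν, withDensity_apply _ measurableSet_Iic,
      integral_eq_lintegral_of_nonneg_ae (Filter.Eventually.of_forall fun x => (hpos x).le)
        hp.aestronglyMeasurable]
  have hF2 : ∀ s, cdf ν s = cdf ν 0 + ∫ x in (0:ℝ)..s, p x := by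
    intro s
    rw [hF, hF, ← intervalIntegral.integral_Iic_sub_Iic hintg.integrableOn hintg.integrableOn]
    ring
  have : (cdf ν : ℝ → ℝ) = fun s => cdf ν 0 + ∫ x in (0:ℝ)..s, p x := funext hF2
  rw [this]
  exact (hp.integral_hasStrictDerivAt 0 t).hasDerivAt.const_add _

lemma cdf_strictMono (p : ℝ → ℝ) (hp : Continuous p) (hpos : ∀ t, 0 < p t) (ν : Measure ℝ)
    [IsProbabilityMeasure ν] (hν : ν = volume.withDensity fun t => ENNReal.ofReal (p t)) :
    StrictMono (cdf ν) := by
  apply strictMono_of_deriv_pos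
  intro t
  rw [(cdf_hasDerivAt p hp hpos ν hν t).deriv]
  exact hpos t

lemma cdf_solve (p q : ℝ → ℝ) (hp : Continuous p) (hpos : ∀ t, 0 < p t) (ν : Measure ℝ)
    [IsProbabilityMeasure ν] (hν : ν = volume.withDensity fun t => ENNReal.ofReal (p t))
    (hq : Continuous q) (hqpos : ∀ t, 0 < q t) (ρ : Measure ℝ)
    [IsProbabilityMeasure ρ] (hρ : ρ = volume.withDensity fun t => ENNReal.ofReal (q t)) (s : ℝ) :
    ∃ u, cdf ν u = cdf ρ s := by
  have hm := cdf_strictMono q hq hqpos ρ hρ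
  have h0 : 0 < cdf ρ s := lt_of_le_of_lt (cdf_nonneg ρ (s - 1)) (hm (by linarith))
  have h1 : cdf ρ s < 1 := lt_of_lt_of_le (hm (by linarith)) (cdf_le_one ρ (s + 1))
  have hc : Continuous (cdf ν) := continuous_iff_continuousAt.2
    fun t => (cdf_hasDerivAt p hp hpos ν hν t).continuousAt
  obtain ⟨a, ha⟩ := ((tendsto_cdf_atBot ν).eventually (gt_mem_nhds h0)).exists
  obtain ⟨b, hb⟩ := ((tendsto_cdf_atTop ν).eventually (lt_mem_nhds h1)).exists
  exact mem_range_of_exists_le_of_exists_ge hc ⟨a, ha.le⟩ ⟨b, hb.le⟩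

lemma gauss_density : gaussianReal 0 1 =
    volume.withDensity fun t => ENNReal.ofReal (gaussianPDFReal 0 1 t) := by
  rw [gaussianReal_of_var_ne_zero 0 one_ne_zero]; rfl

lemma gauss_pdf_cont : Continuous (gaussianPDFReal 0 1) := by
  unfold gaussianPDFReal; fun_prop

lemma transport_1d (p : ℝ → ℝ) (hp : Continuous p) (hpos : ∀ t, 0 < p t) (ν : Measure ℝ)
    [IsProbabilityMeasure ν] (hν : ν = volume.withDensity fun t => ENNReal.ofReal (p t)) :
    ∃ ψ B : ℝ → ℝ, StrictMono ψ ∧ Continuous ψ ∧ ν.map ψ = gaussianReal 0 1 ∧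
      (∀ u, B (ψ u) = u) ∧ StrictMono B ∧ Function.Surjective B ∧ Differentiable ℝ B ∧
      Continuous (deriv B) ∧ ∀ s, 0 < deriv B s := by
  have hφ := gauss_pdf_cont
  have hφp : ∀ t, 0 < gaussianPDFReal 0 1 t := fun t => gaussianPDFReal_pos 0 1 t one_ne_zero
  choose B hB using fun s => cdf_solve p _ hp hpos ν hν hφ hφp _ gauss_density s
  choose ψ hψ using fun s => cdf_solve _ p hφ hφp _ gauss_density hp hpos ν hν s
  have mF := cdf_strictMono p hp hpos ν hν
  have mΦ := cdf_strictMono _ hφ hφp _ gauss_density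
  have hBψ : ∀ u, B (ψ u) = u := fun u => mF.injective (by rw [hB, hψ])
  have hψB : ∀ u, ψ (B u) = u := fun u => mΦ.injective (by rw [hψ, hB])
  have mB : StrictMono B := fun a b hab => mF.lt_iff_lt.1 (by rw [hB, hB]; exact mΦ hab)
  have mψ : StrictMono ψ := fun a b hab => mΦ.lt_iff_lt.1 (by rw [hψ, hψ]; exact mF hab)
  have sB : Function.Surjective B := fun u => ⟨ψ u, hBψ u⟩
  have cB : Continuous B := mB.monotone.continuous_of_surjective sB
  have cψ : Continuous ψ := mψ.monotone.continuous_of_surjective fun u => ⟨B u, hψB u⟩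
  have dB : ∀ s, HasDerivAt B ((p (B s))⁻¹ * gaussianPDFReal 0 1 s) s := by
    intro s
    have := HasDerivAt.of_comp_left (f := cdf ν) (g := B) (h := cdf (gaussianReal 0 1))
      cB.continuousAt (cdf_hasDerivAt p hp hpos ν hν (B s))
      (cdf_hasDerivAt _ hφ hφp _ gauss_density s)
      (hpos _).ne' (Filter.Eventually.of_forall hB)
    rwa [div_eq_inv_mul] at this
  have hdB : deriv B = fun s => (p (B s))⁻¹ * gaussianPDFReal 0 1 s := funext fun s => (dB s).deriv
  refine ⟨ψ, B, mψ, cψ, ?_, hBψ, mB, sB, fun s => (dB s).differentiableAt, ?_, ?_⟩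
  · have : IsProbabilityMeasure (ν.map ψ) :=
      Measure.isProbabilityMeasure_map cψ.measurable.aemeasurable
    apply Measure.eq_of_cdf
    ext s
    rw [← hB, cdf_eq_real, cdf_eq_real, measureReal_def, measureReal_def,
      Measure.map_apply cψ.measurable measurableSet_Iic]
    congr 2
    ext u
    simp only [Set.mem_preimage, Set.mem_Iic]
    rw [← mB.le_iff_le, hBψ]
  · rw [hdB]
    exact ((hp.comp cB).inv₀ fun s => (hpos _).ne').mul hφ
  · intro s
    rw [hdB]
    exact mul_pos (inv_pos.2 (hpos _)) (hφp s)

lemma map_density (B : ℝ → ℝ) (mB : StrictMono B) (sB : Function.Surjective B)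
    (dB : Differentiable ℝ B) (cB' : Continuous (deriv B)) (pB : ∀ s, 0 < deriv B s) :
    ∃ p : ℝ → ℝ, Continuous p ∧ (∀ t, 0 < p t) ∧
      (gaussianReal 0 1).map B = volume.withDensity fun t => ENNReal.ofReal (p t) := by
  have hφ := gauss_pdf_cont
  have hφp : ∀ t, 0 < gaussianPDFReal 0 1 t := fun t => gaussianPDFReal_pos 0 1 t one_ne_zero
  choose A hA using sB
  have hAB : ∀ s, A (B s) = s := fun s => mB.injective (hA _)
  have mA : StrictMono A := fun a b hab => mB.lt_iff_lt.1 (by rwa [hA, hA])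
  have cA : Continuous A := mA.monotone.continuous_of_surjective fun s => ⟨B s, hAB s⟩
  have dA : ∀ u, HasDerivAt A (deriv B (A u))⁻¹ u := fun u =>
    HasDerivAt.of_local_left_inverse cA.continuousAt (dB (A u)).hasDerivAt (pB _).ne'
      (Filter.Eventually.of_forall hA)
  have pA : ∀ u, 0 < (deriv B (A u))⁻¹ := fun u => inv_pos.2 (pB _)
  refine ⟨fun u => (deriv B (A u))⁻¹ * gaussianPDFReal 0 1 (A u),
    ((cB'.comp cA).inv₀ fun u => (pB _).ne').mul (hφ.comp cA),
    fun u => mul_pos (pA u) (hφp _), ?_⟩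
  ext s hs
  rw [Measure.map_apply dB.continuous.measurable hs, withDensity_apply _ hs]
  have himg : B ⁻¹' s = A '' s := by
    ext v
    constructor
    · intro hv; exact ⟨B v, hv, hAB v⟩
    · rintro ⟨u, hu, rfl⟩; simpa [hA] using hu
  rw [gauss_density, withDensity_apply _ (dB.continuous.measurable hs), himg,
    lintegral_image_eq_lintegral_abs_deriv_mul hs (fun u _ => (dA u).hasDerivWithinAt)
      mA.injective.injOn]
  congr 1
  ext u
  rw [ENNReal.ofReal_mul (pA u).le, abs_of_pos (pA u)]

/-! ### The intermediate condition -/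

structure PnlSep {d : ℕ} (S : (Fin d → ℝ) → Fin d → ℝ) (k : Fin d) (B H : ℝ → ℝ)
    (g : (Fin d → ℝ) → ℝ) : Prop where
  mB : StrictMono B
  sB : Function.Surjective B
  dB : Differentiable ℝ B
  cB' : Continuous (deriv B)
  pB : ∀ s, 0 < deriv B s
  mH : StrictMono H
  cH : Continuous H
  sH : Function.Surjective H
  cg : Continuous g
  tg : ∀ x y : Fin d → ℝ, (∀ i < k, x i = y i) → g x = g y
  eq : ∀ x, B (S x k) = H (x k) - g x

lemma invFun_props {h : ℝ → ℝ} (mh : StrictMono h) (bh : Function.Bijective h) :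
    StrictMono (Function.invFun h) ∧ Continuous (Function.invFun h) ∧
      Function.Surjective (Function.invFun h) := by
  have hr : ∀ u, h (Function.invFun h u) = u := Function.rightInverse_invFun bh.surjective
  have hl : ∀ u, Function.invFun h (h u) = u := Function.leftInverse_invFun bh.injective
  have m : StrictMono (Function.invFun h) := fun a b hab => mh.lt_iff_lt.1 (by rwa [hr, hr])
  have s : Function.Surjective (Function.invFun h) := fun u => ⟨h u, hl u⟩
  exact ⟨m, m.monotone.continuous_of_surjective s, s⟩

lemma sep_of_model {d : ℕ} {μ : Measure (Fin d → ℝ)} [IsProbabilityMeasure μ]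
    [μ.IsOpenPosMeasure]
    {S : (Fin d → ℝ) → Fin d → ℝ} (hS : Continuous S)
    (htri : LowerTriangular d S) (hmon : MonotoneLast d S)
    (hpush : μ.map S = Measure.pi fun _ : Fin d => gaussianReal 0 1)
    (h : Fin d → ℝ → ℝ) (g : Fin d → (Fin d → ℝ) → ℝ)
    (hh : ∀ k, StrictMono (h k) ∧ Continuous (h k) ∧ Function.Bijective (h k))
    (hg : ∀ k, Continuous (g k))
    (hgt : ∀ (k : Fin d) (x y : Fin d → ℝ), (∀ i < k, x i = y i) → g k x = g k y)
    (hind : iIndepFun (fun k x => Function.invFun (h k) (x k) - g k x) μ)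
    (hden : ∀ k : Fin d, ∃ p : ℝ → ℝ, Continuous p ∧ (∀ t, 0 < p t) ∧
        μ.map (fun x => Function.invFun (h k) (x k) - g k x) =
          volume.withDensity fun t => ENNReal.ofReal (p t)) (k : Fin d) :
    ∃ B, PnlSep S k B (Function.invFun (h k)) (g k) := by
  have hη := fun k => invFun_props (hh k).1 (hh k).2.2
  have cU : ∀ k, Continuous fun x : Fin d → ℝ => Function.invFun (h k) (x k) - g k x := fun k =>
    ((hη k).2.1.comp (continuous_apply k)).sub (hg k)
  choose p cp pp hp using hden
  have hprob : ∀ k, IsProbabilityMeasure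
      (μ.map (fun x => Function.invFun (h k) (x k) - g k x)) := fun k =>
    Measure.isProbabilityMeasure_map (cU k).measurable.aemeasurable
  choose ψ B mψ cψ hψ hBψ mB sB dB cB' pB using fun k =>
    transport_1d (p k) (cp k) (pp k) _ (hp k)
  set T : (Fin d → ℝ) → Fin d → ℝ :=
    fun x k => ψ k (Function.invFun (h k) (x k) - g k x) with hT
  have cT : Continuous T := continuous_pi fun k => (cψ k).comp (cU k)
  have tT : LowerTriangular d T := by
    intro k x y hxy
    simp only [hT]
    rw [hxy k le_rfl, hgt k x y fun i hi => hxy i hi.le]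
  have mT : MonotoneLast d T := by
    intro k x a b hab
    simp only [hT, Function.update_self]
    apply mψ k
    rw [hgt k (Function.update x k a) (Function.update x k b) fun i hi => by
      simp [Function.update_of_ne hi.ne]]
    have := (hη k).1 hab
    linarith
  have pT : μ.map T = Measure.pi fun _ : Fin d => gaussianReal 0 1 := by
    have hi2 := hind.comp ψ fun k => (cψ k).measurable
    have := hi2.map_fun_eq_pi_map (fun k => ((cψ k).comp (cU k)).measurable.aemeasurable)
    have e : (fun x k => (ψ k ∘ fun x : Fin d → ℝ =>
        Function.invFun (h k) (x k) - g k x) x) = T := rfl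
    rw [e] at this
    rw [this]
    congr 1
    funext k
    rw [← Measure.map_map (cψ k).measurable (cU k).measurable, hψ]
  have hST := kr_unique hS htri hmon cT tT mT (hpush.trans pT.symm) _ k k.2
  exact ⟨B k, mB k, sB k, dB k, cB' k, pB k, (hη k).1, (hη k).2.1, (hη k).2.2, hg k, hgt k,
    fun x => by rw [hST x]; simp only [hT]; rw [hBψ]⟩

lemma model_of_sep {d : ℕ} {μ : Measure (Fin d → ℝ)} [IsProbabilityMeasure μ]
    {S : (Fin d → ℝ) → Fin d → ℝ} (hS : Continuous S)
    (hpush : μ.map S = Measure.pi fun _ : Fin d => gaussianReal 0 1)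
    (hsep : ∀ k, ∃ B H g, PnlSep S k B H g) :
    ∃ (h : Fin d → ℝ → ℝ) (g : Fin d → (Fin d → ℝ) → ℝ),
      (∀ k, StrictMono (h k) ∧ Continuous (h k) ∧ Function.Bijective (h k)) ∧
      (∀ k, Continuous (g k)) ∧
      (∀ (k : Fin d) (x y : Fin d → ℝ), (∀ i < k, x i = y i) → g k x = g k y) ∧
      iIndepFun
        (fun k x => Function.invFun (h k) (x k) - g k x) μ ∧
      ∀ k : Fin d, ∃ p : ℝ → ℝ, Continuous p ∧ (∀ t, 0 < p t) ∧
        μ.map (fun x => Function.invFun (h k) (x k) - g k x) =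
          volume.withDensity fun t => ENNReal.ofReal (p t) := by
  choose B H g hs using hsep
  have bH : ∀ k, Function.Bijective (H k) := fun k => ⟨(hs k).mH.injective, (hs k).sH⟩
  have hprops := fun k => invFun_props (hs k).mH (bH k)
  have hl : ∀ k u, Function.invFun (H k) (H k u) = u := fun k =>
    Function.leftInverse_invFun (bH k).injective
  have hinj : ∀ k, Function.Bijective (Function.invFun (H k)) := fun k =>
    ⟨(hprops k).1.injective, (hprops k).2.2⟩
  have hII : ∀ k, Function.invFun (Function.invFun (H k)) = H k := by
    intro k
    funext u
    apply (hprops k).1.injective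
    rw [hl, Function.rightInverse_invFun (hprops k).2.2 u]
  have hU : ∀ k, (fun x : Fin d → ℝ =>
      Function.invFun (Function.invFun (H k)) (x k) - g k x) = fun x => B k (S x k) := by
    intro k; funext x; rw [hII, (hs k).eq]
  have cSk : ∀ k, Continuous fun x => S x k := fun k => (continuous_apply k).comp hS
  have law : ∀ k, μ.map (fun x => S x k) = gaussianReal 0 1 := by
    intro k
    have : (fun x => S x k) = Function.eval k ∘ S := rfl
    rw [this, ← Measure.map_map (measurable_pi_apply k) hS.measurable, hpush,
      (measurePreserving_eval (fun _ : Fin d => gaussianReal 0 1) k).map_eq]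
  have hindS : iIndepFun (fun k x => S x k) μ := by
    rw [iIndepFun_iff_map_fun_eq_pi_map fun k => (cSk k).measurable.aemeasurable]
    simp only [law]
    exact hpush
  refine ⟨fun k => Function.invFun (H k), g, fun k => ⟨(hprops k).1, (hprops k).2.1, hinj k⟩,
    fun k => (hs k).cg, fun k => (hs k).tg, ?_, ?_⟩
  · have := hindS.comp B fun k => (hs k).dB.continuous.measurable
    have e : (fun k (x : Fin d → ℝ) =>
      Function.invFun (Function.invFun (H k)) (x k) - g k x) = fun k => B k ∘ fun x => S x k :=
      funext hU
    rw [e]; exact this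
  · intro k
    obtain ⟨p, h1, h2, h3⟩ := map_density (B k) (hs k).mB (hs k).sB (hs k).dB (hs k).cB' (hs k).pB
    refine ⟨p, h1, h2, ?_⟩
    rw [hU k, ← h3, ← law k, Measure.map_map (hs k).dB.continuous.measurable (cSk k).measurable]
    rfl

/-! ### Calculus lemmas -/

lemma upd_deriv {d : ℕ} {f : (Fin d → ℝ) → ℝ} (hf : Differentiable ℝ f) (k : Fin d)
    (x : Fin d → ℝ) (t : ℝ) :
    HasDerivAt (fun s => f (Function.update x k s))
      (fderiv ℝ f (Function.update x k t) (Pi.single k 1)) t :=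
  (hf _).hasFDerivAt.comp_hasDerivAt t (hasDerivAt_update x k t)

lemma mixed_zero {d : ℕ} {f : (Fin d → ℝ) → ℝ} (hf : Differentiable ℝ f) (k : Fin d)
    (φ : ℝ → ℝ) (g : (Fin d → ℝ) → ℝ)
    (hgt : ∀ x y : Fin d → ℝ, (∀ i < k, x i = y i) → g x = g y)
    (hfe : ∀ x, f x = φ (x k) - g x) (l : Fin d) (hl : l ≠ k) (x : Fin d → ℝ) :
    fderiv ℝ (fun y => fderiv ℝ f y (Pi.single k 1)) x (Pi.single l 1) = 0 := by
  have hD : (fun y => fderiv ℝ f y (Pi.single k 1)) = fun y => deriv φ (y k) := by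
    funext y
    have h1 := upd_deriv hf k y (y k)
    rw [Function.update_eq_self] at h1
    have h2 : (fun s => f (Function.update y k s)) = fun s => φ s - g y := by
      funext s
      rw [hfe, Function.update_self, hgt (Function.update y k s) y fun i hi => by
        simp [Function.update_of_ne hi.ne]]
    rw [h2] at h1
    rw [← h1.deriv, deriv_sub_const]
  rw [hD]
  by_cases hd : DifferentiableAt ℝ (fun y : Fin d → ℝ => deriv φ (y k)) x
  · have h0 : HasFDerivAt (fun y : Fin d → ℝ => deriv φ (y k)) (fderiv ℝ (fun y : Fin d → ℝ => deriv φ (y k)) x)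
        (Function.update x l (x l)) := by
      rw [Function.update_eq_self]; exact hd.hasFDerivAt
    have h1 := h0.comp_hasDerivAt (x l) (hasDerivAt_update x l (x l))
    have h2 : ((fun y : Fin d → ℝ => deriv φ (y k)) ∘ Function.update x l) =
        fun _ => deriv φ (x k) := by
      funext s
      simp [Function.update_of_ne hl.symm]
    rw [h2] at h1
    exact h1.unique (hasDerivAt_const _ _)
  · rw [fderiv_zero_of_not_differentiableAt hd]; rfl

lemma const_of_mixed {d : ℕ} {D : (Fin d → ℝ) → ℝ} (hD : Differentiable ℝ D) (k : Fin d)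
    (h0 : ∀ l, l ≠ k → ∀ x, fderiv ℝ D x (Pi.single l 1) = 0) (x y : Fin d → ℝ)
    (hxy : x k = y k) : D x = D y := by
  have key : ∀ z, fderiv ℝ D z (y - x) = 0 := by
    intro z
    have : y - x = ∑ l, (y - x) l • (Pi.single l (1 : ℝ) : Fin d → ℝ) := by
      rw [← pi_eq_sum_univ']
    rw [this, map_sum]
    apply Finset.sum_eq_zero
    intro l _
    rw [map_smul]
    by_cases hl : l = k
    · subst hl; simp [hxy]
    · rw [h0 l hl, smul_zero]
  have hder : ∀ t : ℝ, HasDerivAt (fun t : ℝ => D (x + t • (y - x))) 0 t := by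
    intro t
    have h1 : HasDerivAt (fun t : ℝ => x + t • (y - x)) (y - x) t := by
      simpa using ((hasDerivAt_id t).smul_const (y - x)).const_add x
    have := (hD (x + t • (y - x))).hasFDerivAt.comp_hasDerivAt t h1
    rw [key] at this
    exact this
  have := is_const_of_deriv_eq_zero (fun t => (hder t).differentiableAt) (fun t => (hder t).deriv) 0 1
  simpa using this

lemma S_comp_contDiff {d : ℕ} {S : (Fin d → ℝ) → Fin d → ℝ} (hS : ContDiff ℝ 2 S) (k : Fin d) :
    ContDiff ℝ 2 (fun z => S z k) := contDiff_pi.1 hS k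

lemma partial_diff {d : ℕ} {f : (Fin d → ℝ) → ℝ} (hf : ContDiff ℝ 2 f) (v : Fin d → ℝ) :
    Differentiable ℝ fun y => fderiv ℝ f y v := by
  have h1 : ContDiff ℝ 1 (fderiv ℝ f) := hf.fderiv_right (by norm_num)
  have h2 := h1.differentiable (by norm_num)
  fun_prop

lemma sep_decomp {d : ℕ} {S : (Fin d → ℝ) → Fin d → ℝ} (hS : ContDiff ℝ 2 S)
    (htri : LowerTriangular d S) (k : Fin d) {B : ℝ → ℝ}
    (dB : Differentiable ℝ B) (dB2 : Differentiable ℝ (deriv B))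
    (hmix : ∀ l : Fin d, l ≠ k → ∀ x : Fin d → ℝ,
        fderiv ℝ (fun y => fderiv ℝ (fun z => B (S z k)) y (Pi.single k 1)) x
          (Pi.single l 1) = 0) :
    ∃ H g, Differentiable ℝ H ∧ Differentiable ℝ g ∧
      (∀ x y : Fin d → ℝ, (∀ i < k, x i = y i) → g x = g y) ∧
      ∀ x, B (S x k) = H (x k) - g x := by
  have hSk := S_comp_contDiff hS k
  have dSk : Differentiable ℝ fun z => S z k := hSk.differentiable (by norm_num)
  set f : (Fin d → ℝ) → ℝ := fun z => B (S z k) with hfdef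
  have df : Differentiable ℝ f := dB.comp dSk
  have hDe : (fun y => fderiv ℝ f y (Pi.single k 1)) =
      fun y => deriv B (S y k) * fderiv ℝ (fun z => S z k) y (Pi.single k 1) := by
    funext y
    have := (dB (S y k)).hasDerivAt.comp_hasFDerivAt y (dSk y).hasFDerivAt
    rw [show f = B ∘ fun z => S z k from rfl, this.fderiv]
    simp
  have dD : Differentiable ℝ (fun y => fderiv ℝ f y (Pi.single k 1)) := by
    rw [hDe]
    exact (dB2.comp dSk).mul (partial_diff hSk _)
  have hcD := const_of_mixed dD k hmix
  have hupd : ∀ x : Fin d → ℝ, ∀ t, HasDerivAt (fun s => f (Function.update x k s))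
    (fderiv ℝ f (Function.update x k t) (Pi.single k 1)) t := fun x t => upd_deriv df k x t
  refine ⟨fun t => f (Function.update 0 k t),
    fun x => f (Function.update 0 k 0) - f (Function.update x k 0),
    fun t => (hupd 0 t).differentiableAt, ?_, ?_, ?_⟩
  · have : Differentiable ℝ fun x : Fin d → ℝ => Function.update x k (0:ℝ) := by
      rw [differentiable_pi]
      intro i
      by_cases hi : i = k
      · subst hi; simp
      · simp only [Function.update_of_ne hi]; fun_prop
    exact (df.comp this).const_sub _
  · intro x y hxy
    have : S (Function.update x k 0) k = S (Function.update y k 0) k := by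
      apply htri
      intro i hi
      rcases hi.eq_or_lt with rfl | hi
      · simp
      · simp [Function.update_of_ne hi.ne, hxy i hi]
    simp only [hfdef, this]
  · intro x
    have hz : ∀ t, HasDerivAt (fun s => f (Function.update x k s) - f (Function.update 0 k s)) 0 t := by
      intro t
      have := (hupd x t).sub (hupd 0 t)
      rwa [hcD (Function.update x k t) (Function.update 0 k t) (by simp), sub_self] at this
    have := is_const_of_deriv_eq_zero (fun t => (hz t).differentiableAt)
      (fun t => (hz t).deriv) (x k) 0
    simp only [Function.update_eq_self] at this
    change f x = _
    linarith

lemma unbounded_cases {B : ℝ → ℝ} (mB : StrictMono B) (dB : Continuous B)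
    (h1 : ∀ M, ∃ s, M < B s) (h2 : ∀ M, ∃ s, B s < M) : Function.Surjective B := by
  intro u
  obtain ⟨a, ha⟩ := h2 u
  obtain ⟨b, hb⟩ := h1 u
  exact mem_range_of_exists_le_of_exists_ge dB ⟨a, ha.le⟩ ⟨b, hb.le⟩

lemma sep_of_b {d : ℕ} {μ : Measure (Fin d → ℝ)}
    {S : (Fin d → ℝ) → Fin d → ℝ} (hS : ContDiff ℝ 2 S)
    (htri : LowerTriangular d S) (hmon : MonotoneLast d S)
    (hpush : μ.map S = Measure.pi fun _ : Fin d => gaussianReal 0 1) (k : Fin d) {B : ℝ → ℝ}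
    (mB : StrictMono B)
    (dB : Differentiable ℝ B) (dB2 : Differentiable ℝ (deriv B))
    (hmix : ∀ l : Fin d, l ≠ k → ∀ x : Fin d → ℝ,
        fderiv ℝ (fun y => fderiv ℝ (fun z => B (S z k)) y (Pi.single k 1)) x
          (Pi.single l 1) = 0) :
    ∃ B H g, PnlSep S k B H g := by
  obtain ⟨H, g, dH, dg, tg, heq⟩ := sep_decomp hS htri k dB dB2 hmix
  have hc : Continuous S := hS.continuous
  have dSk : Differentiable ℝ fun z => S z k :=
    (S_comp_contDiff hS k).differentiable (by norm_num)
  have gup : ∀ x t, g (Function.update x k t) = g x := fun x t => tg _ _ fun i hi => by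
    simp [Function.update_of_ne hi.ne]
  have eup : ∀ x t, B (S (Function.update x k t) k) = H t - g x := fun x t => by
    rw [heq, gup, Function.update_self]
  have mH : StrictMono H := by
    intro a b hab
    have := mB (hmon k 0 hab)
    simp only [eup] at this
    linarith
  have near := exists_near hc htri hmon hpush k g dg.continuous tg
  by_cases hconst : ∀ x y, g x = g y
  · have hS0 : ∀ x, S x k = S (Function.update 0 k (x k)) k := by
      intro x
      apply mB.injective
      rw [eup, heq, hconst x 0]
    have mH' : StrictMono fun t => S (Function.update 0 k t) k := hmon k 0
    have cH' : Continuous fun t => S (Function.update 0 k t) k :=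
      dSk.continuous.comp (continuous_const.update k continuous_id)
    refine ⟨id, fun t => S (Function.update 0 k t) k, fun _ => 0, strictMono_id,
      Function.surjective_id, differentiable_id, ?_, ?_, mH', cH', ?_, continuous_const,
      fun _ _ _ => rfl, fun x => by simp [← hS0 x]⟩
    · have : deriv (id : ℝ → ℝ) = fun _ => 1 := by funext s; simp
      rw [this]; exact continuous_const
    · intro s; simp
    · apply unbounded_cases mH' cH'
      · intro M
        obtain ⟨x, -, hx⟩ := near 0 1 one_pos (Set.Ioi M) isOpen_Ioi ⟨M + 1, by simp⟩
        exact ⟨x k, by rw [← hS0]; exact hx⟩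
      · intro M
        obtain ⟨x, -, hx⟩ := near 0 1 one_pos (Set.Iio M) isOpen_Iio ⟨M - 1, by simp⟩
        exact ⟨x k, by rw [← hS0]; exact hx⟩
  · have hne : ∃ y1 y2, g y1 < g y2 := by
      push Not at hconst
      obtain ⟨x, y, hxy⟩ := hconst
      rcases lt_or_gt_of_ne hxy with h | h
      · exact ⟨x, y, h⟩
      · exact ⟨y, x, h⟩
    obtain ⟨y1, y2, hlt⟩ := hne
    have hε : 0 < (g y2 - g y1) / 2 := by linarith
    have hup : ∀ M, ∃ s, M < B s := by
      by_contra! hcon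
      obtain ⟨M0, hM0⟩ := hcon
      have hbdd : BddAbove (Set.range B) := ⟨M0, by rintro _ ⟨s, rfl⟩; exact hM0 s⟩
      obtain ⟨_, ⟨s0, rfl⟩, hs0⟩ := exists_lt_of_lt_csSup (Set.range_nonempty B)
        (show sSup (Set.range B) - (g y2 - g y1) / 2 < sSup (Set.range B) by linarith)
      obtain ⟨x, hx1, hx2⟩ := near y2 _ hε (Set.Ioi s0) isOpen_Ioi ⟨s0 + 1, by simp⟩
      have h1 := mB hx2
      rw [heq] at h1
      have h2 := le_csSup hbdd ⟨_, eup y1 (x k)⟩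
      have h3 := abs_lt.1 hx1
      linarith [h3.1]
    have hdn : ∀ M, ∃ s, B s < M := by
      by_contra! hcon
      obtain ⟨M0, hM0⟩ := hcon
      have hbdd : BddBelow (Set.range B) := ⟨M0, by rintro _ ⟨s, rfl⟩; exact hM0 s⟩
      obtain ⟨_, ⟨s0, rfl⟩, hs0⟩ := exists_lt_of_csInf_lt (Set.range_nonempty B)
        (show sInf (Set.range B) < sInf (Set.range B) + (g y2 - g y1) / 2 by linarith)
      obtain ⟨x, hx1, hx2⟩ := near y1 _ hε (Set.Iio s0) isOpen_Iio ⟨s0 - 1, by simp⟩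
      have h1 := mB hx2
      rw [heq] at h1
      have h2 := csInf_le hbdd ⟨_, eup y2 (x k)⟩
      have h3 := abs_lt.1 hx1
      linarith [h3.2]
    have sB : Function.Surjective B := unbounded_cases mB dB.continuous hup hdn
    have sH : Function.Surjective H := by
      apply unbounded_cases mH dH.continuous
      · intro M
        obtain ⟨s0, hs0⟩ := hup (M - g 0 + 1)
        obtain ⟨x, hx1, hx2⟩ := near 0 1 one_pos (Set.Ioi s0) isOpen_Ioi ⟨s0 + 1, by simp⟩
        have h1 := mB hx2
        rw [heq] at h1
        have h3 := abs_lt.1 hx1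
        exact ⟨x k, by linarith [h3.1]⟩
      · intro M
        obtain ⟨s0, hs0⟩ := hdn (M - g 0 - 1)
        obtain ⟨x, hx1, hx2⟩ := near 0 1 one_pos (Set.Iio s0) isOpen_Iio ⟨s0 - 1, by simp⟩
        have h1 := mB hx2
        rw [heq] at h1
        have h3 := abs_lt.1 hx1
        exact ⟨x k, by linarith [h3.2]⟩
    refine ⟨B, H, g, mB, sB, dB, dB2.continuous, ?_, mH, dH.continuous, sH, dg.continuous, tg, heq⟩
    intro s0
    apply lt_of_le_of_ne (mB.monotone.deriv_nonneg)
    intro h0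
    obtain ⟨t1, ht1⟩ := sH (B s0 + g y1)
    obtain ⟨t2, ht2⟩ := sH (B s0 + g y2)
    have ht : t1 < t2 := mH.lt_iff_lt.1 (by linarith)
    have hz : ∀ t ∈ Set.Ioo t1 t2, deriv H t = 0 := by
      intro t htm
      have ha := mH htm.1
      have hb := mH htm.2
      obtain ⟨y, hy⟩ := mem_range_of_exists_le_of_exists_ge dg.continuous
        (c := H t - B s0) ⟨y1, by linarith⟩ ⟨y2, by linarith⟩
      have hs : S (Function.update y k t) k = s0 := by
        apply mB.injective
        rw [eup]; linarith
      have h1 := upd_deriv dSk k y t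
      have h2 : HasDerivAt B 0 (S (Function.update y k t) k) := by
        rw [hs, h0]; exact (dB s0).hasDerivAt
      have h3 := (h2.comp t h1).add_const (g y)
      have h4 : (fun x => (B ∘ fun s => S (Function.update y k s) k) x + g y) = H := by
        funext s
        simp [eup]
      rw [zero_mul] at h3
      exact (h4 ▸ h3).deriv
    obtain ⟨c, hcm, hce⟩ := exists_deriv_eq_slope H ht dH.continuous.continuousOn
      dH.differentiableOn
    rw [hz c hcm] at hce
    have := mH ht
    have h5 : 0 < (H t2 - H t1) / (t2 - t1) := div_pos (by linarith) (by linarith)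
    linarith

lemma b_of_sep {d : ℕ} {S : (Fin d → ℝ) → Fin d → ℝ} (hS : ContDiff ℝ 2 S)
    (hdiag : ∀ x k, fderiv ℝ (fun z => S z k) x (Pi.single k 1) ≠ 0)
    (k : Fin d) {B H : ℝ → ℝ} {g : (Fin d → ℝ) → ℝ} (hs : PnlSep S k B H g) :
    ∃ B : ℝ → ℝ, StrictMono B ∧ Differentiable ℝ B ∧
      Differentiable ℝ (deriv B) ∧
      ∀ l : Fin d, l ≠ k → ∀ x : Fin d → ℝ,
        fderiv ℝ (fun y => fderiv ℝ (fun z => B (S z k)) y (Pi.single k 1)) x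
          (Pi.single l 1) = 0 := by
  obtain ⟨mB, sB, dB, -, pB, mH, cH, sH, cg, tg, heq⟩ := hs
  have hSk := S_comp_contDiff hS k
  have dSk : Differentiable ℝ fun z => S z k := hSk.differentiable (by norm_num)
  have gup : ∀ x t, g (Function.update x k t) = g x := fun x t => tg _ _ fun i hi => by
    simp [Function.update_of_ne hi.ne]
  have eup : ∀ x t, B (S (Function.update x k t) k) = H t - g x := fun x t => by
    rw [heq, gup, Function.update_self]
  by_cases hconst : ∀ x y, g x = g y
  · have hS0 : ∀ x, S x k = S (Function.update 0 k (x k)) k := by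
      intro x
      apply mB.injective
      rw [eup, heq, hconst x 0]
    refine ⟨id, strictMono_id, differentiable_id, ?_, ?_⟩
    · have : deriv (id : ℝ → ℝ) = fun _ => 1 := by funext s; simp
      rw [this]; exact differentiable_const _
    · exact mixed_zero (f := fun z => id (S z k)) dSk k (fun t => S (Function.update 0 k t) k)
        (fun _ => 0) (fun _ _ _ => rfl) fun x => by simp [← hS0 x]
  · refine ⟨B, mB, dB, ?_, mixed_zero (dB.comp dSk) k H g tg heq⟩
    have hH : ∀ x t, HasDerivAt H (deriv B (S (Function.update x k t) k) *
        fderiv ℝ (fun z => S z k) (Function.update x k t) (Pi.single k 1)) t := by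
      intro x t
      have h1 := upd_deriv dSk k x t
      have h3 := ((dB (S (Function.update x k t) k)).hasDerivAt.comp t h1).add_const (g x)
      have h4 : (fun s => (B ∘ fun s => S (Function.update x k s) k) s + g x) = H := by
        funext s
        simp [eup]
      rwa [h4] at h3
    have dH : Differentiable ℝ H := fun t => (hH 0 t).differentiableAt
    have hge : g = fun x => H (x k) - B (S x k) := by funext x; rw [heq]; ring
    have dg : Differentiable ℝ g := by
      rw [hge]
      exact (dH.comp (differentiable_apply k)).sub (dB.comp dSk)
    have hex : ∃ y0 v, fderiv ℝ g y0 v ≠ 0 := by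
      by_contra! hcon
      exact hconst (is_const_of_fderiv_eq_zero dg fun x => by ext v; simp [hcon x])
    obtain ⟨y0, v, hv⟩ := hex
    intro u0
    obtain ⟨t, ht⟩ := sH (B u0 + g y0)
    have hu0 : S (Function.update y0 k t) k = u0 := by
      apply mB.injective
      rw [eup, ht]; ring
    set c : ℝ → Fin d → ℝ := fun s => Function.update (y0 + s • v) k t with hcdef
    have cc : ContDiff ℝ 2 c := by
      rw [contDiff_pi]
      intro i
      by_cases hi : i = k
      · subst hi; simp only [hcdef, Function.update_self]; exact contDiff_const
      · simp only [hcdef, Function.update_of_ne hi, Pi.add_apply, Pi.smul_apply]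
        fun_prop
    have dc : Differentiable ℝ c := cc.differentiable (by norm_num)
    have c0 : c 0 = Function.update y0 k t := by simp [hcdef]
    set σ : ℝ → ℝ := fun s => S (c s) k with hσ
    have cσ : ContDiff ℝ 2 σ := hSk.comp cc
    have σ0 : σ 0 = u0 := by simp only [hσ, c0, hu0]
    have hstr : HasStrictDerivAt σ (deriv σ 0) 0 :=
      cσ.contDiffAt.hasStrictDerivAt (by norm_num)
    have hne : deriv σ 0 ≠ 0 := by
      intro h0
      have h1 : HasDerivAt (fun s => B (σ s)) (deriv B (σ 0) * 0) 0 :=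
        (dB (σ 0)).hasDerivAt.comp 0 (by have := hstr.hasDerivAt; rwa [h0] at this)
      have h2 : HasDerivAt (fun s : ℝ => y0 + s • v) v 0 := by
        simpa using ((hasDerivAt_id (0:ℝ)).smul_const v).const_add y0
      have h3 : HasFDerivAt g (fderiv ℝ g y0) (y0 + (0:ℝ) • v) := by
        simpa using (dg y0).hasFDerivAt
      have h4 := (h3.comp_hasDerivAt (0:ℝ) h2).const_sub (H t)
      have h5 : (fun s => B (σ s)) = fun s => H t - (g ∘ fun s : ℝ => y0 + s • v) s := by
        funext s
        simp only [hσ, hcdef, eup, Function.comp]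
      rw [h5] at h1
      have := h4.unique h1
      simp at this
      exact hv this
    set q : ℝ → ℝ := fun s => deriv H t / fderiv ℝ (fun z => S z k) (c s) (Pi.single k 1) with hq
    have dq : Differentiable ℝ q := by
      intro s
      exact (differentiableAt_const _).div (((partial_diff hSk (Pi.single k 1)).comp dc) s) (hdiag _ _)
    have hBq : ∀ s, deriv B (σ s) = q s := by
      intro s
      have := (hH (y0 + s • v) t).deriv
      simp only [hq, this]
      rw [mul_div_assoc, div_self (hdiag _ _), mul_one]
    have hinv := hstr.to_localInverse hne
    have hev := (hstr.hasStrictFDerivAt_equiv hne).eventually_right_inverse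
    have h1 : DifferentiableAt ℝ (q ∘ hstr.localInverse σ (deriv σ 0) 0 hne) (σ 0) :=
      (dq _).comp _ hinv.hasDerivAt.differentiableAt
    rw [σ0] at h1 hev
    refine h1.congr_of_eventuallyEq ?_
    filter_upwards [hev] with u hu
    simp only [Function.comp]
    rw [← hBq]
    congr 1
    exact hu.symm

/-- Characterization of post-nonlinear models (identity ordering) via the Knothe–Rosenblatt map:
for a probability measure `μ` with smooth positive density `π` and a `C²` lower triangular
monotone map `S` transporting `μ` to the standard Gaussian `γ^d`, `μ` is induced by a
post-nonlinear model `X_k = h_k(g_k(X_1,…,X_{k-1}) + U_k)` (with strictly increasing continuous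
bijections `h_k` and mutually independent noises `U_k = h_k⁻¹(X_k) − g_k(X)` having positive
continuous densities) if and only if for each `k` there is a strictly increasing twice
differentiable `B_k : ℝ → ℝ` with `∂²/∂x_ℓ ∂x_k [B_k(S_k(x))] = 0` everywhere, for every
`ℓ ≠ k`. -/
theorem stmt9 (d : ℕ) (hd : 1 ≤ d)
    (π : (Fin d → ℝ) → ℝ) (hpos : ∀ x, 0 < π x) (hsmooth : ContDiff ℝ 2 π)
    (μ : Measure (Fin d → ℝ))
    (hμ : μ = volume.withDensity fun x => ENNReal.ofReal (π x))
    [IsProbabilityMeasure μ]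
    (S : (Fin d → ℝ) → Fin d → ℝ)
    (hSreg : ContDiff ℝ 2 S)
    (htri : LowerTriangular d S) (hmon : MonotoneLast d S)
    (hpush : μ.map S = Measure.pi fun _ : Fin d => gaussianReal 0 1) :
    (∃ (h : Fin d → ℝ → ℝ) (g : Fin d → (Fin d → ℝ) → ℝ),
      (∀ k, StrictMono (h k) ∧ Continuous (h k) ∧ Function.Bijective (h k)) ∧
      (∀ k, Continuous (g k)) ∧
      (∀ (k : Fin d) (x y : Fin d → ℝ), (∀ i < k, x i = y i) → g k x = g k y) ∧
      iIndepFun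
        (fun k x => Function.invFun (h k) (x k) - g k x) μ ∧
      ∀ k : Fin d, ∃ p : ℝ → ℝ, Continuous p ∧ (∀ t, 0 < p t) ∧
        μ.map (fun x => Function.invFun (h k) (x k) - g k x) =
          volume.withDensity fun t => ENNReal.ofReal (p t)) ↔
    (∀ k : Fin d, ∃ B : ℝ → ℝ, StrictMono B ∧ Differentiable ℝ B ∧
      Differentiable ℝ (deriv B) ∧
      ∀ l : Fin d, l ≠ k → ∀ x : Fin d → ℝ,
        fderiv ℝ (fun y => fderiv ℝ (fun z => B (S z k)) y (Pi.single k 1)) x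
          (Pi.single l 1) = 0) := by
  have hop : μ.IsOpenPosMeasure := by
    rw [hμ]; exact mu_isOpenPos hpos hsmooth.continuous
  constructor
  · rintro ⟨h, g, hh, hg, hgt, hind, hden⟩ k
    obtain ⟨B, hB⟩ := sep_of_model hSreg.continuous htri hmon hpush h g hh hg hgt hind hden k
    exact b_of_sep hSreg
      (diag_ne_zero hpos hsmooth.continuous hμ hSreg htri hmon hpush) k hB
  · intro hb
    refine model_of_sep hSreg.continuous hpush fun k => ?_
    obtain ⟨B, mB, dB, dB2, hmix⟩ := hb k
    exact sep_of_b hSreg htri hmon hpush k mB dB dB2 hmix
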